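/- Let 0 ≤ θ_min ≤ θ_max and 0 ≤ η_min ≤ η_max be real numbers with θ_min² + η_max² > 0, Ω = [θ_min, θ_max] × [η_min, η_max], and for γ > 0 define f(γ) = max_{(θ,η) ∈ Ω} ((γ − θ)² + η²) / ((γ + θ)² + η²). Suppose η_max ≥ √(θ_min(θ_max − θ_min)/2), and set γ* = √(θ_min² + η_max²). Then γ* > 0, f(γ*) = (√(θ_min² + η_max²) − θ_min) / (√(θ_min² + η_max²) + θ_min), and f(γ) ≥ f(γ*) for every γ > 0; that is, the minimum over γ > 0 of f(γ) is attained at γ = γ*. -/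

import Mathlib

/-- `rectMax θmin θmax ηmin ηmax γ` is
`max_{(θ,η) ∈ [θmin,θmax] × [ηmin,ηmax]} ((γ-θ)² + η²)/((γ+θ)² + η²)`. -/
noncomputable def rectMax (θmin θmax ηmin ηmax γ : ℝ) : ℝ :=
  ⨆ p ∈ Set.Icc θmin θmax ×ˢ Set.Icc ηmin ηmax,
    ((γ - p.1) ^ 2 + p.2 ^ 2) / ((γ + p.1) ^ 2 + p.2 ^ 2)

/-- The ratio maximised in `rectMax` is at most `1` for nonnegative `γ` and `θ`. -/
theorem ratio_le_one {γ θ : ℝ} (hγ : 0 ≤ γ) (hθ : 0 ≤ θ) (η : ℝ) :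
    ((γ - θ) ^ 2 + η ^ 2) / ((γ + θ) ^ 2 + η ^ 2) ≤ 1 :=
  div_le_one_of_le₀ (by nlinarith [mul_nonneg hγ hθ]) (by positivity)

theorem le_rectMax {θmin θmax ηmin ηmax γ θ η : ℝ} (hθ0 : 0 ≤ θmin) (hγ : 0 ≤ γ)
    (hθ : θ ∈ Set.Icc θmin θmax) (hη : η ∈ Set.Icc ηmin ηmax) :
    ((γ - θ) ^ 2 + η ^ 2) / ((γ + θ) ^ 2 + η ^ 2) ≤ rectMax θmin θmax ηmin ηmax γ := by
  have hp : (θ, η) ∈ Set.Icc θmin θmax ×ˢ Set.Icc ηmin ηmax := ⟨hθ, hη⟩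
  have hbdd : BddAbove (Set.range fun p : ℝ × ℝ =>
      ⨆ _ : p ∈ Set.Icc θmin θmax ×ˢ Set.Icc ηmin ηmax,
        ((γ - p.1) ^ 2 + p.2 ^ 2) / ((γ + p.1) ^ 2 + p.2 ^ 2)) := by
    refine ⟨1, ?_⟩
    rintro _ ⟨p, rfl⟩
    exact Real.iSup_le (fun h => ratio_le_one hγ (hθ0.trans h.1.1) p.2) zero_le_one
  refine le_trans ?_ (le_ciSup hbdd (θ, η))
  simp only [ciSup_pos hp, le_refl]

theorem rectMax_le {θmin θmax ηmin ηmax γ c : ℝ} (hc : 0 ≤ c)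
    (h : ∀ θ ∈ Set.Icc θmin θmax, ∀ η ∈ Set.Icc ηmin ηmax,
      ((γ - θ) ^ 2 + η ^ 2) / ((γ + θ) ^ 2 + η ^ 2) ≤ c) :
    rectMax θmin θmax ηmin ηmax γ ≤ c :=
  Real.iSup_le (fun p => Real.iSup_le (fun hp => h p.1 hp.1 p.2 hp.2) hc) hc

/-- Among all `γ > 0`, the ratio at the corner `(a, h)` is smallest at `γ = √(a² + h²)`. -/
theorem le_ratio_corner {a h g γ : ℝ} (ha : 0 ≤ a) (hg : 0 < g) (hg2 : g ^ 2 = a ^ 2 + h ^ 2)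
    (hγ : 0 < γ) :
    (g - a) / (g + a) ≤ ((γ - a) ^ 2 + h ^ 2) / ((γ + a) ^ 2 + h ^ 2) := by
  rw [div_le_div_iff₀ (by positivity) (by positivity)]
  have hh : h ^ 2 = g ^ 2 - a ^ 2 := by linarith
  rw [hh]
  nlinarith [mul_nonneg ha (sq_nonneg (γ - g))]

/-- At `γ = √(a² + h²)`, the ratio over `θ ∈ [a, b]`, `|η| ≤ h` is largest at `(a, h)`. -/
theorem ratio_le_corner {a b h g θ η : ℝ} (ha : 0 ≤ a) (hg : 0 < g)
    (hg2 : g ^ 2 = a ^ 2 + h ^ 2) (hlarge : a * (b - a) / 2 ≤ h ^ 2)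
    (hθ : θ ∈ Set.Icc a b) (hη : η ^ 2 ≤ h ^ 2) :
    ((g - θ) ^ 2 + η ^ 2) / ((g + θ) ^ 2 + η ^ 2) ≤ (g - a) / (g + a) := by
  have hθ0 : 0 ≤ θ := ha.trans hθ.1
  rw [div_le_div_iff₀ (by positivity) (by positivity)]
  have hfac : 0 ≤ 2 * g ^ 2 - a * (a + θ) := by
    nlinarith [mul_le_mul_of_nonneg_left hθ.2 ha]
  have hprod := mul_nonneg (sub_nonneg.2 hθ.1) hfac
  have hmono := mul_le_mul_of_nonneg_left hη ha
  have hh : h ^ 2 = g ^ 2 - a ^ 2 := by linarith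
  rw [hh] at hmono
  linarith

theorem optimal_gamma_large_eta
    (θmin θmax ηmin ηmax : ℝ)
    (hθ0 : 0 ≤ θmin) (hθ : θmin ≤ θmax) (hη0 : 0 ≤ ηmin) (hη : ηmin ≤ ηmax)
    (hpos : 0 < θmin ^ 2 + ηmax ^ 2)
    (hlarge : Real.sqrt (θmin * (θmax - θmin) / 2) ≤ ηmax)
    (γstar : ℝ) (hγstar : γstar = Real.sqrt (θmin ^ 2 + ηmax ^ 2)) :
    0 < γstar ∧
    rectMax θmin θmax ηmin ηmax γstar
      = (Real.sqrt (θmin ^ 2 + ηmax ^ 2) - θmin) / (Real.sqrt (θmin ^ 2 + ηmax ^ 2) + θmin) ∧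
    ∀ γ : ℝ, 0 < γ → rectMax θmin θmax ηmin ηmax γstar ≤ rectMax θmin θmax ηmin ηmax γ := by
  have hsq : Real.sqrt (θmin ^ 2 + ηmax ^ 2) ^ 2 = θmin ^ 2 + ηmax ^ 2 := Real.sq_sqrt hpos.le
  rw [← hγstar] at hsq ⊢
  have hg : 0 < γstar := hγstar ▸ Real.sqrt_pos.2 hpos
  have hη1 : 0 ≤ ηmax := hη0.trans hη
  have hlarge' : θmin * (θmax - θmin) / 2 ≤ ηmax ^ 2 := (Real.sqrt_le_left hη1).1 hlarge
  have hle : θmin ≤ γstar := by nlinarith [sq_nonneg ηmax]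
  have hlower : ∀ γ : ℝ, 0 < γ →
      (γstar - θmin) / (γstar + θmin) ≤ rectMax θmin θmax ηmin ηmax γ := fun γ hγ =>
    (le_ratio_corner hθ0 hg hsq hγ).trans
      (le_rectMax hθ0 hγ.le (Set.left_mem_Icc.2 hθ) (Set.right_mem_Icc.2 hη))
  have hupper : rectMax θmin θmax ηmin ηmax γstar ≤ (γstar - θmin) / (γstar + θmin) :=
    rectMax_le (div_nonneg (sub_nonneg.2 hle) (by positivity)) fun θ hθ' η hη' =>
      ratio_le_corner hθ0 hg hsq hlarge' hθ'
        (pow_le_pow_left₀ (hη0.trans hη'.1) hη'.2 2)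
  exact ⟨hg, hupper.antisymm (hlower γstar hg), fun γ hγ => hupper.trans (hlower γ hγ)⟩
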